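/- arXiv:1206.4032 — 3 statements merged into one kernel-verified Lean document; each statement's English description precedes it below -/
import Mathlib

section
/- The multiple-ions Pauli measurement scheme is informationally complete: if ρ and ρ' are 2^k × 2^k Hermitian complex matrices such that P_ρ(s|d) = P_{ρ'}(s|d) for every setting d ∈ {x,y,z}^k and every outcome s ∈ {+1,−1}^k, then ρ = ρ'. -/
open Matrix Complex

/-- The unit eigenvectors `e_s^d ∈ ℂ²` of the Pauli matrices: `eigvec d s` is the
eigenvector of `σ_d` (`d = 0,1,2` for `x,y,z`) with eigenvalue `+1` for `s = 0` and
eigenvalue `-1` for `s = 1`. -/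
noncomputable def eigvec : Fin 3 → Fin 2 → (Fin 2 → ℂ) :=
  ![![![(Real.sqrt 2 : ℂ)⁻¹, (Real.sqrt 2 : ℂ)⁻¹],
     ![(Real.sqrt 2 : ℂ)⁻¹, -(Real.sqrt 2 : ℂ)⁻¹]],
   ![![(Real.sqrt 2 : ℂ)⁻¹, (Real.sqrt 2 : ℂ)⁻¹ * I],
     ![(Real.sqrt 2 : ℂ)⁻¹, -((Real.sqrt 2 : ℂ)⁻¹ * I)]],
   ![![1, 0], ![0, 1]]]

/-- The tensor-product basis vector `e_s^d := e_{s_1}^{d_1} ⊗ ⋯ ⊗ e_{s_k}^{d_k} ∈ ℂ^{2^k}`,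
realised as a vector indexed by `Fin k → Fin 2`. -/
noncomputable def eigvecTensor {k : ℕ} (d : Fin k → Fin 3) (s : Fin k → Fin 2) :
    (Fin k → Fin 2) → ℂ :=
  fun a => ∏ j, eigvec (d j) (s j) (a j)

/-- The outcome probability `P_ρ(s|d) := ⟨e_s^d, ρ e_s^d⟩`. -/
noncomputable def probOf {k : ℕ} (ρ : Matrix (Fin k → Fin 2) (Fin k → Fin 2) ℂ)
    (d : Fin k → Fin 3) (s : Fin k → Fin 2) : ℂ :=
  ∑ a : Fin k → Fin 2, ∑ b : Fin k → Fin 2,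
    (starRingEnd ℂ) (eigvecTensor d s a) * ρ a b * eigvecTensor d s b

/-- Dual frame coefficients: the matrix unit `E_{pq}` as a combination of Pauli projectors. -/
noncomputable def dualCoeff : Fin 2 → Fin 2 → Fin 3 → Fin 2 → ℂ :=
  ![![![![0, 0], ![0, 0], ![1, 0]], ![![1/2, -1/2], ![-I/2, I/2], ![0, 0]]],
    ![![![1/2, -1/2], ![I/2, -I/2], ![0, 0]], ![![0, 0], ![0, 0], ![0, 1]]]]

theorem sqrt_two_inv_mul_self : (Real.sqrt 2 : ℂ)⁻¹ * (Real.sqrt 2 : ℂ)⁻¹ = 1 / 2 := by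
  rw [← mul_inv, ← Complex.ofReal_mul, Real.mul_self_sqrt (by norm_num)]
  norm_num

theorem dualCoeff_spec (p q a b : Fin 2) :
    ∑ t : Fin 3 × Fin 2, dualCoeff p q t.1 t.2 *
      ((starRingEnd ℂ) (eigvec t.1 t.2 a) * eigvec t.1 t.2 b) =
    (if a = p then 1 else 0) * (if b = q then 1 else 0) := by
  have h := sqrt_two_inv_mul_self
  have hI := Complex.I_mul_I
  rw [Fintype.sum_prod_type]
  generalize hr : (Real.sqrt 2 : ℂ)⁻¹ = r at h
  have hc : (starRingEnd ℂ) r = r := by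
    rw [← hr, map_inv₀, Complex.conj_ofReal]
  fin_cases p <;> fin_cases q <;> fin_cases a <;> fin_cases b <;>
    simp [Fin.sum_univ_succ, dualCoeff, eigvec, hr, hc] <;> grind

theorem dual_sum {k : ℕ} (ρ : Matrix (Fin k → Fin 2) (Fin k → Fin 2) ℂ)
    (p q : Fin k → Fin 2) :
    ∑ t : Fin k → Fin 3 × Fin 2, (∏ j, dualCoeff (p j) (q j) (t j).1 (t j).2) *
      probOf ρ (fun j => (t j).1) (fun j => (t j).2) = ρ p q := by
  have key : ∀ a b : Fin k → Fin 2,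
      ∑ t : Fin k → Fin 3 × Fin 2, (∏ j, dualCoeff (p j) (q j) (t j).1 (t j).2) *
        ((starRingEnd ℂ) (eigvecTensor (fun j => (t j).1) (fun j => (t j).2) a) *
          eigvecTensor (fun j => (t j).1) (fun j => (t j).2) b) =
      (if a = p then 1 else 0) * (if b = q then 1 else 0) := by
    intro a b
    simp only [eigvecTensor, map_prod, ← Finset.prod_mul_distrib]
    rw [← Fintype.piFinset_univ, ← Finset.prod_univ_sum (fun _ => Finset.univ)
      (fun j (t : Fin 3 × Fin 2) => dualCoeff (p j) (q j) t.1 t.2 *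
      ((starRingEnd ℂ) (eigvec t.1 t.2 (a j)) * eigvec t.1 t.2 (b j)))]
    simp only [dualCoeff_spec, Finset.prod_mul_distrib, Finset.prod_ite_zero,
      Finset.prod_const_one, Finset.mem_univ, forall_const, funext_iff, true_imp_iff]
  calc _ = ∑ a, ∑ b, (∑ t : Fin k → Fin 3 × Fin 2,
        (∏ j, dualCoeff (p j) (q j) (t j).1 (t j).2) *
        ((starRingEnd ℂ) (eigvecTensor (fun j => (t j).1) (fun j => (t j).2) a) *
          eigvecTensor (fun j => (t j).1) (fun j => (t j).2) b)) * ρ a b := by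
        simp only [probOf, Finset.mul_sum, Finset.sum_mul]
        rw [Finset.sum_comm]
        refine Finset.sum_congr rfl fun a _ => ?_
        rw [Finset.sum_comm]
        refine Finset.sum_congr rfl fun b _ => Finset.sum_congr rfl fun t _ => ?_
        ring
    _ = ρ p q := by
        simp only [key]
        simp

/-- Informational completeness of the multiple-ions Pauli measurement scheme: two Hermitian
matrices giving the same outcome probabilities `P_ρ(s|d)` for all settings `d ∈ {x,y,z}^k`
and outcomes `s ∈ {+1,-1}^k` must be equal. -/
theorem pauli_measurement_informationally_complete (k : ℕ)
    (ρ ρ' : Matrix (Fin k → Fin 2) (Fin k → Fin 2) ℂ)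
    (hρ : ρ.IsHermitian) (hρ' : ρ'.IsHermitian)
    (h : ∀ (d : Fin k → Fin 3) (s : Fin k → Fin 2), probOf ρ d s = probOf ρ' d s) :
    ρ = ρ' := by
  ext p q
  rw [← dual_sum ρ p q, ← dual_sum ρ' p q]
  simp only [h]
end

section
/- Cholesky factorization of generic rank-r positive semidefinite matrices: let ρ be a d × d positive semidefinite complex matrix of rank r (1 ≤ r ≤ d) whose top-left r × r principal submatrix (ρ_{ij})_{1 ≤ i,j ≤ r} is invertible. Then there exists a unique matrix T ∈ T^+(d,r) such that ρ = TᴴT. -/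
open Matrix Complex ComplexOrder

/-- `T^+(d,r)`: the set of `d × d` upper triangular complex matrices whose rows with
(0-based) index `≥ r` vanish and whose first `r` diagonal entries are real and strictly
positive. -/
def TPlus (d r : ℕ) : Set (Matrix (Fin d) (Fin d) ℂ) :=
  {T | (∀ i j : Fin d, j < i → T i j = 0) ∧
       (∀ i j : Fin d, r ≤ (i : ℕ) → T i j = 0) ∧
       (∀ i : Fin d, (i : ℕ) < r → (T i i).im = 0 ∧ 0 < (T i i).re)}

theorem chol_unique (d r : ℕ) (S T : Matrix (Fin d) (Fin d) ℂ) (hS : S ∈ TPlus d r)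
    (hT : T ∈ TPlus d r) (h : Sᴴ * S = Tᴴ * T) : S = T := by
  obtain ⟨hS1, hS2, hS3⟩ := hS
  obtain ⟨hT1, hT2, hT3⟩ := hT
  have key : ∀ i : Fin d, ∀ j, S i j = T i j := by
    intro i
    induction i using WellFoundedLT.induction with
    | _ i ih =>
    by_cases hi : (i : ℕ) < r
    swap
    · intro j
      rw [hS2 i j (by omega), hT2 i j (by omega)]
    have e : ∀ j, star (S i i) * S i j = star (T i i) * T i j := by
      intro j
      have h1 := congrFun (congrFun h i) j
      simp only [mul_apply, conjTranspose_apply] at h1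
      rw [← Finset.add_sum_erase _ _ (Finset.mem_univ i),
        ← Finset.add_sum_erase _ (fun k => star (T k i) * T k j) (Finset.mem_univ i)] at h1
      have h2 : ∑ k ∈ Finset.univ.erase i, star (S k i) * S k j
          = ∑ k ∈ Finset.univ.erase i, star (T k i) * T k j := by
        apply Finset.sum_congr rfl
        intro k hk
        rcases lt_or_gt_of_ne (Finset.ne_of_mem_erase hk) with hlt | hgt
        · rw [ih k hlt, ih k hlt]
        · rw [hS1 k i hgt, hT1 k i hgt]; simp
      rw [h2] at h1
      exact add_right_cancel h1
    obtain ⟨s1, s2⟩ := hS3 i hi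
    obtain ⟨t1, t2⟩ := hT3 i hi
    have hd : S i i = T i i := by
      have := congrArg Complex.re (e i)
      simp [s1, t1] at this
      apply Complex.ext
      · nlinarith
      · rw [s1, t1]
    intro j
    have := e j
    rw [hd] at this
    refine mul_left_cancel₀ ?_ this
    intro h0
    have := congrArg Complex.re h0
    simp at this
    linarith
  ext i j
  exact key i j

theorem exists_vectors (d : ℕ) (ρ : Matrix (Fin d) (Fin d) ℂ) (hρ : ρ.PosSemidef) :
    ∃ v : Fin d → EuclideanSpace ℂ (Fin d), gram ℂ v = ρ ∧
      Module.finrank ℂ (Submodule.span ℂ (Set.range v)) = ρ.rank := by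
  obtain ⟨B, rfl⟩ : ∃ B : Matrix (Fin d) (Fin d) ℂ, ρ = Bᴴ * B := by
    open scoped MatrixOrder Matrix.Norms.L2Operator in
    exact CStarAlgebra.nonneg_iff_eq_star_mul_self.mp hρ.nonneg
  refine ⟨fun j => WithLp.toLp 2 (B.col j), ?_, ?_⟩
  · ext i j
    simp [gram_apply, mul_apply, PiLp.inner_apply, mul_comm]
  · rw [rank_conjTranspose_mul_self, rank_eq_finrank_span_cols]
    rw [← LinearEquiv.finrank_map_eq (WithLp.linearEquiv 2 ℂ (Fin d → ℂ)), Submodule.map_span,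
      ← Set.range_comp]
    rfl

theorem chol_exists (d r : ℕ) (hrd : r ≤ d)
    (ρ : Matrix (Fin d) (Fin d) ℂ) (hρ : ρ.PosSemidef) (hrank : ρ.rank = r)
    (hminor : IsUnit (ρ.submatrix (Fin.castLE hrd) (Fin.castLE hrd))) :
    ∃ T : Matrix (Fin d) (Fin d) ℂ, T ∈ TPlus d r ∧ ρ = Tᴴ * T := by
  obtain ⟨v, rfl, hv⟩ := exists_vectors d ρ hρ
  have hli : LinearIndependent ℂ (v ∘ Fin.castLE hrd) := by
    apply linearIndependent_of_det_gram_ne_zero (𝕜 := ℂ)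
    exact ((isUnit_iff_isUnit_det _).mp hminor).ne_zero
  have hspan : Submodule.span ℂ (Set.range (v ∘ Fin.castLE hrd))
      = Submodule.span ℂ (Set.range v) := by
    apply Submodule.eq_of_le_of_finrank_eq
    · exact Submodule.span_mono (Set.range_comp_subset_range _ _)
    · rw [finrank_span_eq_card hli, hv, hrank, Fintype.card_fin]
  have hcard : Module.finrank ℂ (EuclideanSpace ℂ (Fin d)) = Fintype.card (Fin d) := by simp
  set b := InnerProductSpace.gramSchmidtOrthonormalBasis hcard v with hb
  refine ⟨of fun i j => b.repr (v j) i, ⟨?_, ?_, ?_⟩, gram_eq_conjTranspose_mul b v⟩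
  · intro i j hij
    exact InnerProductSpace.gramSchmidtOrthonormalBasis_inv_triangular' hcard v hij
  · intro i j hi
    rw [of_apply, b.repr_apply_apply]
    have hj : v j ∈ Submodule.span ℂ (Set.range (v ∘ Fin.castLE hrd)) := by
      rw [hspan]; exact Submodule.subset_span ⟨j, rfl⟩
    generalize v j = w at hj ⊢
    induction hj using Submodule.span_induction with
    | mem x hx =>
      obtain ⟨k, rfl⟩ := hx
      apply InnerProductSpace.gramSchmidtOrthonormalBasis_inv_triangular hcard v
      rw [Fin.lt_def, Fin.val_castLE]
      omega
    | zero => simp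
    | add x y _ _ hx hy => rw [inner_add_right, hx, hy, add_zero]
    | smul a x _ hx => rw [inner_smul_right, hx, mul_zero]
  · intro i hi
    have hg : InnerProductSpace.gramSchmidt ℂ v i ≠ 0 := by
      apply InnerProductSpace.gramSchmidt_ne_zero_coe
      have := hli.comp (fun k : Set.Iic i => (⟨(k : Fin d), lt_of_le_of_lt k.2 hi⟩ : Fin r))
        (by intro x y hxy; simpa [Fin.ext_iff, Subtype.ext_iff] using hxy)
      exact this
    have hn : InnerProductSpace.gramSchmidtNormed ℂ v i ≠ 0 := by
      simp [InnerProductSpace.gramSchmidtNormed, hg]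
    have hin : inner ℂ (InnerProductSpace.gramSchmidt ℂ v i) (v i)
        = (‖InnerProductSpace.gramSchmidt ℂ v i‖ : ℂ) ^ 2 := by
      conv_lhs => rw [InnerProductSpace.gramSchmidt_def'' ℂ v i]
      rw [inner_add_right, inner_sum, Finset.sum_eq_zero, add_zero, inner_self_eq_norm_sq_to_K]
      · rfl
      · intro k hk
        rw [inner_smul_right, InnerProductSpace.gramSchmidt_orthogonal ℂ v
          (Finset.mem_Iio.mp hk).ne', mul_zero]
    have hval : b.repr (v i) i = ((‖InnerProductSpace.gramSchmidt ℂ v i‖ : ℝ) : ℂ) := by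
      rw [b.repr_apply_apply, hb, InnerProductSpace.gramSchmidtOrthonormalBasis_apply hcard hn,
        InnerProductSpace.gramSchmidtNormed, inner_smul_left, hin]
      have : (‖InnerProductSpace.gramSchmidt ℂ v i‖ : ℂ) ≠ 0 := by simpa using hg
      simp
      field_simp
    rw [of_apply, hval]
    simpa using hg

/-- Cholesky factorization of generic rank-`r` positive semidefinite matrices: if `ρ` is a
`d × d` positive semidefinite matrix of rank `r` (`1 ≤ r ≤ d`) whose top-left `r × r`
principal submatrix is invertible, then there is a unique `T ∈ T^+(d,r)` with `ρ = Tᴴ T`. -/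
theorem cholesky_of_rank_r_posSemidef (d r : ℕ) (hr : 1 ≤ r) (hrd : r ≤ d)
    (ρ : Matrix (Fin d) (Fin d) ℂ) (hρ : ρ.PosSemidef) (hrank : ρ.rank = r)
    (hminor : IsUnit (ρ.submatrix (Fin.castLE hrd) (Fin.castLE hrd))) :
    ∃! T : Matrix (Fin d) (Fin d) ℂ, T ∈ TPlus d r ∧ ρ = Tᴴ * T := by
  obtain ⟨T, hT, hρT⟩ := chol_exists d r hrd ρ hρ hrank hminor
  refine ⟨T, ⟨hT, hρT⟩, ?_⟩
  rintro S ⟨hS, hρS⟩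
  exact chol_unique d r S T hS hT (hρS.symm.trans hρT)
end

section
/- The Cholesky-parametrized models describe all states of rank at most r: for integers 1 ≤ r ≤ d, the set { TᴴT : T ∈ T(d,r), Tr(TᴴT) = 1 } is exactly the set of d × d density matrices of rank at most r. In particular, every positive semidefinite matrix ρ with rank(ρ) ≤ r admits a (not necessarily unique) factorization ρ = TᴴT with T upper triangular and rows r+1,…,d of T equal to zero, and these models are nested in r. -/
open Matrix Complex ComplexOrder

/-- `T(d,r)`: the set of `d × d` upper triangular complex matrices whose rows with
(0-based) index `≥ r` vanish and whose first `r` diagonal entries are real and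
nonnegative. -/
def TSet (d r : ℕ) : Set (Matrix (Fin d) (Fin d) ℂ) :=
  {T | (∀ i j : Fin d, j < i → T i j = 0) ∧
       (∀ i j : Fin d, r ≤ (i : ℕ) → T i j = 0) ∧
       (∀ i : Fin d, (i : ℕ) < r → (T i i).im = 0 ∧ 0 ≤ (T i i).re)}

/-- The rank-`r` Cholesky model: the set of matrices `Tᴴ T` with `T ∈ T(d,r)` and
`Tr(Tᴴ T) = 1`. -/
def cholModel (d r : ℕ) : Set (Matrix (Fin d) (Fin d) ℂ) :=
  {ρ | ∃ T ∈ TSet d r, (Tᴴ * T).trace = 1 ∧ ρ = Tᴴ * T}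

theorem aux_rank_le {d r : ℕ} (hrd : r ≤ d) (T : Matrix (Fin d) (Fin d) ℂ)
    (h : ∀ i j : Fin d, r ≤ (i : ℕ) → T i j = 0) : T.rank ≤ r := by
  have hT : T = (Matrix.of fun (i : Fin d) (k : Fin r) => if (i : ℕ) = k then (1 : ℂ) else 0) *
      (Matrix.of fun (k : Fin r) (j : Fin d) => T (Fin.castLE hrd k) j) := by
    ext i j
    rw [Matrix.mul_apply]
    by_cases hi : (i : ℕ) < r
    · rw [Finset.sum_eq_single (⟨i, hi⟩ : Fin r)]
      · simp
      · intro b _ hb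
        have : ¬ (i : ℕ) = b := fun h => hb (Fin.ext h.symm)
        simp [this]
      · simp
    · rw [h i j (by omega), Finset.sum_eq_zero]
      intro k _
      have : ¬ (i : ℕ) = k := by omega
      simp [this]
  rw [hT]
  refine (Matrix.rank_mul_le_right _ _).trans ?_
  simpa using Matrix.rank_le_card_height (Matrix.of fun (k : Fin r) (j : Fin d) => T (Fin.castLE hrd k) j)

theorem aux_zero {d : ℕ} (ρ : Matrix (Fin (d + 1)) (Fin (d + 1)) ℂ) (hρ : ρ.PosSemidef)
    (h0 : ρ 0 0 = 0) (j : Fin (d + 1)) : ρ 0 j = 0 ∧ ρ j 0 = 0 := by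
  obtain ⟨B, rfl⟩ : ∃ B : Matrix (Fin (d + 1)) (Fin (d + 1)) ℂ, ρ = Bᴴ * B := by
    open scoped MatrixOrder in
    exact CStarAlgebra.nonneg_iff_eq_star_mul_self.mp hρ.nonneg
  have hB : ∀ k, B k 0 = 0 := by
    rw [Matrix.mul_apply] at h0
    have := (Finset.sum_eq_zero_iff_of_nonneg (fun i _ => by
      rw [Matrix.conjTranspose_apply]; exact star_mul_self_nonneg (B i 0))).mp h0
    intro k
    simpa using this k (Finset.mem_univ k)
  constructor <;> simp [Matrix.mul_apply, hB]

theorem aux_schur {d : ℕ} (ρ : Matrix (Fin (d + 1)) (Fin (d + 1)) ℂ) (hρ : ρ.PosSemidef)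
    (h0 : ρ 0 0 ≠ 0) (S : Matrix (Fin d) (Fin d) ℂ)
    (hS : ∀ i j, S i j = ρ i.succ j.succ - ρ i.succ 0 * ρ 0 j.succ / ρ 0 0) :
    S.PosSemidef ∧ S.rank + 1 ≤ ρ.rank := by
  have hH : ∀ i j, star (ρ i j) = ρ j i := fun i j => hρ.1.apply j i
  constructor
  · let W : Matrix (Fin (d + 1)) (Fin d) ℂ :=
      Matrix.of fun i j => Fin.cases (- ρ 0 j.succ / ρ 0 0) (fun i => (1 : Matrix (Fin d) (Fin d) ℂ) i j) i
    have hW0 : ∀ j, W 0 j = - ρ 0 j.succ / ρ 0 0 := fun j => rfl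
    have hW1 : ∀ i j, W (Fin.succ i) j = (1 : Matrix (Fin d) (Fin d) ℂ) i j := fun i j => rfl
    have : S = Wᴴ * ρ * W := by
      ext i j
      simp only [Matrix.mul_apply, Fin.sum_univ_succ, hW0, hW1, Matrix.conjTranspose_apply,
        Matrix.one_apply, hS, star_div₀, star_neg, hH]
      simp
      field_simp
      ring
    rw [this]
    exact hρ.conjTranspose_mul_mul_same W
  · have h1 := LinearMap.finrank_range_add_finrank_ker S.mulVecLin
    have h2 := LinearMap.finrank_range_add_finrank_ker ρ.mulVecLin
    have key : ∀ x : Fin (d + 1) → ℂ, ρ *ᵥ x = 0 →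
        S *ᵥ (fun i => x i.succ) = 0 ∧ x 0 = - (∑ j : Fin d, ρ 0 j.succ * x j.succ) / ρ 0 0 := by
      intro x hx
      have e0 := congrFun hx 0
      simp only [Matrix.mulVec, dotProduct, Fin.sum_univ_succ, Pi.zero_apply] at e0
      have hx0 : x 0 = - (∑ j : Fin d, ρ 0 j.succ * x j.succ) / ρ 0 0 := by
        rw [eq_div_iff h0]; linear_combination e0
      refine ⟨?_, hx0⟩
      ext i
      have ei := congrFun hx i.succ
      simp only [Matrix.mulVec, dotProduct, Fin.sum_univ_succ, Pi.zero_apply] at ei ⊢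
      rw [hx0] at ei
      rw [← ei]
      simp only [hS, sub_mul, Finset.sum_sub_distrib]
      have : ∑ j : Fin d, ρ i.succ 0 * ρ 0 j.succ / ρ 0 0 * x j.succ
          = ρ i.succ 0 / ρ 0 0 * ∑ j : Fin d, ρ 0 j.succ * x j.succ := by
        rw [Finset.mul_sum]
        exact Finset.sum_congr rfl fun j _ => by ring
      rw [this]; ring
    let p : (Fin (d + 1) → ℂ) →ₗ[ℂ] (Fin d → ℂ) := LinearMap.funLeft ℂ ℂ Fin.succ
    have hp : ∀ x ∈ LinearMap.ker ρ.mulVecLin, p x ∈ LinearMap.ker S.mulVecLin := by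
      intro x hx
      exact (key x hx).1
    have hinj : Function.Injective (p.restrict hp) := by
      rw [← LinearMap.ker_eq_bot, LinearMap.ker_eq_bot']
      rintro ⟨x, hx⟩ hx'
      have hz : ∀ i : Fin d, x i.succ = 0 := fun i => congrFun (congrArg Subtype.val hx') i
      have h00 := (key x hx).2
      simp only [hz] at h00
      apply Subtype.ext
      ext i
      refine Fin.cases ?_ ?_ i
      · simpa using h00
      · exact hz
    have h3 := LinearMap.finrank_le_finrank_of_injective hinj
    simp only [Module.finrank_fin_fun] at h1 h2
    unfold Matrix.rank
    omega

theorem aux_chol (d : ℕ) : ∀ (r : ℕ) (ρ : Matrix (Fin d) (Fin d) ℂ), ρ.PosSemidef →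
    ρ.rank ≤ r → ∃ T ∈ TSet d r, ρ = Tᴴ * T := by
  induction d with
  | zero =>
    intro r ρ _ _
    exact ⟨0, ⟨fun i => i.elim0, fun i => i.elim0, fun i => i.elim0⟩, by ext i; exact i.elim0⟩
  | succ d ih =>
    intro r ρ hρ hr
    have hH : ∀ i j, star (ρ i j) = ρ j i := fun i j => hρ.1.apply j i
    by_cases h0 : ρ 0 0 = 0
    · have hsub : (ρ.submatrix Fin.succ Fin.succ).rank ≤ r :=
        (Matrix.rank_submatrix_le _ _ _).trans hr
      obtain ⟨T, ⟨hT1, hT2, hT3⟩, hT⟩ := ih r _ (hρ.submatrix Fin.succ) hsub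
      let U : Matrix (Fin (d + 1)) (Fin (d + 1)) ℂ :=
        Matrix.of fun i j => Fin.lastCases 0 (fun i => Fin.cases 0 (fun j => T i j) j) i
      have hl : ∀ j, U (Fin.last d) j = 0 := fun j => by simp [U]
      have hc0 : ∀ i : Fin d, U i.castSucc 0 = 0 := fun j => by simp [U]
      have hc : ∀ i j : Fin d, U i.castSucc j.succ = T i j := fun i j => by simp [U]
      have hU0 : ∀ i, U i 0 = 0 := fun i => by
        refine Fin.lastCases (hl 0) hc0 i
      have hUd : ∀ i j, j ≤ i → U i j = 0 := by
        intro i j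
        refine Fin.lastCases (fun _ => hl j) (fun i => ?_) i
        refine Fin.cases (fun _ => hc0 i) (fun j hij => ?_) j
        rw [hc]
        apply hT1
        simp only [Fin.le_def, Fin.lt_def, Fin.val_succ, Fin.val_castSucc] at *
        omega
      refine ⟨U, ⟨fun i j hij => hUd i j hij.le, ?_, fun i _ => by simp [hUd i i le_rfl]⟩, ?_⟩
      · intro i j
        refine Fin.lastCases (fun _ => hl j) (fun i => ?_) i
        refine Fin.cases (fun _ => hc0 i) (fun j hij => ?_) j
        rw [hc]
        exact hT2 _ _ hij
      · ext i j
        refine Fin.cases ?_ (fun i => ?_) i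
        · simp [(aux_zero ρ hρ h0 j).1, Matrix.mul_apply, hU0]
        · refine Fin.cases ?_ (fun j => ?_) j
          · simp [(aux_zero ρ hρ h0 i.succ).2, Matrix.mul_apply, hU0]
          · have := congrFun (congrFun hT i) j
            simp only [Matrix.submatrix_apply, Matrix.mul_apply, Matrix.conjTranspose_apply] at this
            rw [this, Matrix.mul_apply, Fin.sum_univ_castSucc]
            simp [hl, hc]
    · obtain ⟨hS, hSr⟩ := aux_schur ρ hρ h0
        (Matrix.of fun i j => ρ i.succ j.succ - ρ i.succ 0 * ρ 0 j.succ / ρ 0 0) (fun _ _ => rfl)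
      obtain ⟨r, rfl⟩ : ∃ s, r = s + 1 := ⟨r - 1, by omega⟩
      obtain ⟨T, ⟨hT1, hT2, hT3⟩, hT⟩ := ih r _ hS (by omega)
      have hnn : 0 ≤ ρ 0 0 := hρ.diag_nonneg
      obtain ⟨a, ha, haρ⟩ : ∃ a : ℝ, 0 ≤ a ∧ (a : ℂ) = ρ 0 0 :=
        ⟨(ρ 0 0).re, (Complex.le_def.mp hnn).1, by
          apply Complex.ext
          · simp
          · simpa using (Complex.le_def.mp hnn).2⟩
      have hs : ((√a : ℝ) : ℂ) * ((√a : ℝ) : ℂ) = ρ 0 0 := by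
        rw [← Complex.ofReal_mul, Real.mul_self_sqrt ha, haρ]
      have hs0 : ((√a : ℝ) : ℂ) ≠ 0 := by
        intro h; rw [h] at hs; simp at hs; exact h0 hs.symm
      let U : Matrix (Fin (d + 1)) (Fin (d + 1)) ℂ :=
        Matrix.of fun i j => Fin.cases (ρ 0 j / ((√a : ℝ) : ℂ))
          (fun i => Fin.cases 0 (fun j => T i j) j) i
      have hU0 : ∀ j, U 0 j = ρ 0 j / ((√a : ℝ) : ℂ) := fun _ => rfl
      have hUs0 : ∀ i : Fin d, U i.succ 0 = 0 := fun _ => rfl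
      have hUs : ∀ i j : Fin d, U i.succ j.succ = T i j := fun _ _ => rfl
      have hU00 : U 0 0 = ((√a : ℝ) : ℂ) := by
        rw [hU0, ← hs]; field_simp
      refine ⟨U, ⟨?_, ?_, ?_⟩, ?_⟩
      · intro i j
        refine Fin.cases (fun h => absurd h (Fin.not_lt_zero j)) (fun i => ?_) i
        refine Fin.cases (fun _ => hUs0 i) (fun j hij => ?_) j
        rw [hUs]
        exact hT1 _ _ (Fin.succ_lt_succ_iff.mp hij)
      · intro i j
        refine Fin.cases (fun h => by simp at h) (fun i => ?_) i
        refine Fin.cases (fun _ => hUs0 i) (fun j hij => ?_) j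
        rw [hUs]
        exact hT2 _ _ (by simpa using hij)
      · intro i
        refine Fin.cases (fun _ => ?_) (fun i hi => ?_) i
        · rw [hU00]; simp [Real.sqrt_nonneg]
        · rw [hUs]; exact hT3 i (by simpa using hi)
      · ext i j
        have e0 : ∀ i j, star (U 0 i) * U 0 j = ρ i 0 * ρ 0 j / ρ 0 0 := by
          intro i j
          rw [hU0, hU0, star_div₀, hH, ← hs]
          simp only [Complex.star_def, Complex.conj_ofReal]
          field_simp
        rw [Matrix.mul_apply, Fin.sum_univ_succ]
        simp only [Matrix.conjTranspose_apply, e0]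
        refine Fin.cases ?_ (fun i => ?_) i
        · simp only [hUs0]; simp; field_simp
        · refine Fin.cases ?_ (fun j => ?_) j
          · simp only [hUs0]; simp; field_simp
          · have := congrFun (congrFun hT i) j
            simp only [Matrix.of_apply, Matrix.mul_apply, Matrix.conjTranspose_apply] at this
            simp only [hUs]
            rw [← this]; ring

/-- The Cholesky-parametrized models describe all states of rank at most `r`: for
`1 ≤ r ≤ d`, the set `{Tᴴ T : T ∈ T(d,r), Tr(Tᴴ T) = 1}` is exactly the set of `d × d`
density matrices of rank at most `r`; in particular every positive semidefinite matrix of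
rank at most `r` factors as `Tᴴ T` with `T` upper triangular with rows of index `≥ r`
zero, and the models are nested in `r`. -/
theorem cholModel_eq_low_rank_states (d r : ℕ) (hr : 1 ≤ r) (hrd : r ≤ d) :
    cholModel d r
        = {ρ : Matrix (Fin d) (Fin d) ℂ | ρ.PosSemidef ∧ ρ.trace = 1 ∧ ρ.rank ≤ r} ∧
    (∀ ρ : Matrix (Fin d) (Fin d) ℂ, ρ.PosSemidef → ρ.rank ≤ r →
      ∃ T : Matrix (Fin d) (Fin d) ℂ,
        (∀ i j : Fin d, j < i → T i j = 0) ∧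
        (∀ i j : Fin d, r ≤ (i : ℕ) → T i j = 0) ∧
        ρ = Tᴴ * T) ∧
    (∀ r' : ℕ, r ≤ r' → cholModel d r ⊆ cholModel d r') := by
  refine ⟨?_, ?_, ?_⟩
  · ext ρ
    constructor
    · rintro ⟨T, hT, htr, rfl⟩
      refine ⟨Matrix.posSemidef_conjTranspose_mul_self T, htr, ?_⟩
      rw [Matrix.rank_conjTranspose_mul_self]
      exact aux_rank_le hrd T hT.2.1
    · rintro ⟨hρ, htr, hrk⟩
      obtain ⟨T, hT, rfl⟩ := aux_chol d r ρ hρ hrk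
      exact ⟨T, hT, htr, rfl⟩
  · intro ρ hρ hrk
    obtain ⟨T, hT, h⟩ := aux_chol d r ρ hρ hrk
    exact ⟨T, hT.1, hT.2.1, h⟩
  · rintro r' hr' ρ ⟨T, ⟨h1, h2, h3⟩, h⟩
    refine ⟨T, ⟨h1, fun i j hi => h2 i j (hr'.trans hi), fun i _ => ?_⟩, h⟩
    by_cases hi : (i : ℕ) < r
    · exact h3 i hi
    · simp [h2 i i (by omega)]
end
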